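/- Let n >= 1 and let q be a prime power. Let pi be an n-dimensional projective subspace of PG(2n+1,q^2) such that pi intersect pi^sigma has projective dimension at least n-1. Then the set of points of H(2n+1,q^2) lying on pi equals the set of points of H(2n+1,q^2) lying on pi^sigma, and both equal the set of points of pi intersect pi^sigma. -/

import Mathlib

open scoped BigOperators

namespace HermCode

/-- The Hermitian sesquilinear form `h(x,y) = ∑ᵢ xᵢ * yᵢ^q` on `F^m`. -/
def herm (q : ℕ) {F : Type} [Field F] {m : ℕ} (x y : Fin m → F) : F :=
  ∑ i, x i * (y i) ^ q

/-- For a fixed vector `x`, the linear map `y ↦ h(y,x)`. -/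
def hermL (q : ℕ) {F : Type} [Field F] {m : ℕ} (x : Fin m → F) :
    (Fin m → F) →ₗ[F] F where
  toFun y := herm q y x
  map_add' a b := by
    simp [herm, add_mul, Finset.sum_add_distrib]
  map_smul' c a := by
    simp [herm, Finset.mul_sum, mul_assoc]

/-- The image `W^σ` of a subspace `W` under the Hermitian polarity `σ`:
the subspace of all vectors orthogonal to every vector of `W`
with respect to the Hermitian form. -/
def polar (q : ℕ) {F : Type} [Field F] {m : ℕ} (W : Submodule F (Fin m → F)) :
    Submodule F (Fin m → F) :=
  ⨅ x : W, LinearMap.ker (hermL q (x : Fin m → F))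

/-- A subspace all of whose points lie on the Hermitian variety. -/
def TotallyIsotropic (q : ℕ) {F : Type} [Field F] {m : ℕ}
    (W : Submodule F (Fin m → F)) : Prop :=
  ∀ x ∈ W, herm q x x = 0

/-- A point of the Hermitian variety: a projective point (1-dimensional subspace)
spanned by an isotropic vector. -/
def IsHermPoint (q : ℕ) {F : Type} [Field F] {m : ℕ}
    (P : Submodule F (Fin m → F)) : Prop :=
  Module.finrank F P = 1 ∧ TotallyIsotropic q P

/-- A generator of `H(2n+1,q²)`: an `n`-dimensional projective subspace all of
whose points lie on the Hermitian variety. -/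
def IsGenerator (q n : ℕ) {F : Type} [Field F]
    (W : Submodule F (Fin (2*n+2) → F)) : Prop :=
  Module.finrank F W = n + 1 ∧ TotallyIsotropic q W

/-- A code word of the dual code `C_n(H(2n+1,q²))^⊥`: a function from points to `F_p`
(vanishing off the Hermitian variety) summing to zero over every generator. -/
def IsCodeword (p q n : ℕ) {F : Type} [Field F]
    (c : Submodule F (Fin (2*n+2) → F) → ZMod p) : Prop :=
  (∀ P, ¬ IsHermPoint q P → c P = 0) ∧
  ∀ μ, IsGenerator q n μ → (∑ᶠ P ∈ {P | IsHermPoint q P ∧ P ≤ μ}, c P) = 0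

/-- The (Hamming) weight of a code word. -/
noncomputable def wt {p : ℕ} {α : Type*} (c : α → ZMod p) : ℕ :=
  Nat.card {x : α // c x ≠ 0}

open scoped Classical in
/-- The incidence vector `v_π` of `π ∩ H`. -/
noncomputable def vsub (p q : ℕ) {F : Type} [Field F] {m : ℕ}
    (π : Submodule F (Fin m → F)) : Submodule F (Fin m → F) → ZMod p :=
  fun P => if IsHermPoint q P ∧ P ≤ π then 1 else 0

/-- `θ_m(q)`, the number of points of `PG(m,q)`. -/
noncomputable def theta (q : ℕ) (m : ℤ) : ℚ :=
  ((q:ℚ)^(m+1) - 1) / ((q:ℚ) - 1)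

/-- `μ_m(q²)`, the number of points of `H(m,q²)` (with `μ_{-1} = 0`). -/
noncomputable def muH (q : ℕ) (m : ℤ) : ℚ :=
  (((q:ℚ)^(m+1) - (-1:ℚ)^(m+1)) * ((q:ℚ)^m - (-1:ℚ)^m)) / ((q:ℚ)^2 - 1)

/-- The number `N(n,i)`. -/
noncomputable def NN (q n : ℕ) (i : ℤ) : ℚ :=
  (q:ℚ)^(((n:ℤ)-1)^2 - ((((n:ℤ)-i-1).toNat.choose 2 : ℕ) : ℤ)) *
    ∏ j ∈ Finset.range ((n:ℤ)-i-2).toNat, ((q:ℚ)^(j+1) - (-1:ℚ)^(j+1))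

open scoped Classical in
/-- The quantity `Σ_{n,i}`. -/
noncomputable def SigmaNI (q n : ℕ) (i : ℤ) : ℚ :=
  if Odd ((n:ℤ) - i) then
    2*(q:ℚ)^(2*i+2) * muH q ((n:ℤ)-i-1)
      + 4 * muH q ((n:ℤ)-i-2) * ((q:ℚ)^((n:ℤ)-i-1) - 1)
          / ((q:ℚ)^((n:ℤ)-3*i-5) * ((q:ℚ)^2 - 1))
  else
    2*(q:ℚ)^(2*i+2) * (muH q ((n:ℤ)-i-1)
      + 2*((q:ℚ)^(4:ℤ) * muH q ((n:ℤ)-i-3) + (q:ℚ)^2 - 1)/((q:ℚ)^2 - 1))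

/-- `P` lies on a projective line entirely contained in the Hermitian variety that
meets both `π \ (π ⊓ π^σ)` and `π^σ \ (π ⊓ π^σ)`. -/
def OnGoodLine (q : ℕ) {F : Type} [Field F] {m : ℕ}
    (π P : Submodule F (Fin m → F)) : Prop :=
  ∃ A B : Submodule F (Fin m → F),
    Module.finrank F A = 1 ∧ A ≤ π ∧ ¬ A ≤ π ⊓ polar q π ∧
    Module.finrank F B = 1 ∧ B ≤ polar q π ∧ ¬ B ≤ π ⊓ polar q π ∧
    P ≤ A ⊔ B ∧ TotallyIsotropic q (A ⊔ B)

theorem mem_polar {q : ℕ} {F : Type} [Field F] {m : ℕ} {W : Submodule F (Fin m → F)}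
    {y : Fin m → F} : y ∈ polar q W ↔ ∀ x ∈ W, herm q y x = 0 := by
  simp only [polar, Submodule.mem_iInf, LinearMap.mem_ker, Subtype.forall]
  exact Iff.rfl

theorem herm_add_left {q : ℕ} {F : Type} [Field F] {m : ℕ} (a b x : Fin m → F) :
    herm q (a + b) x = herm q a x + herm q b x := (hermL q x).map_add a b

theorem herm_smul_left {q : ℕ} {F : Type} [Field F] {m : ℕ} (c : F) (b x : Fin m → F) :
    herm q (c • b) x = c * herm q b x := (hermL q x).map_smul c b

theorem herm_swap {p hh : ℕ} {F : Type} [Field F] [Fintype F] [ExpChar F p]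
    (hF : Fintype.card F = (p ^ hh) ^ 2) {m : ℕ} (x y : Fin m → F) :
    herm (p ^ hh) x y ^ (p ^ hh) = herm (p ^ hh) y x := by
  unfold herm
  rw [sum_pow_char_pow]
  refine Finset.sum_congr rfl fun i _ => ?_
  rw [mul_pow, ← pow_mul, ← sq, ← hF, FiniteField.pow_card, mul_comm]

theorem herm_symm0 {p hh : ℕ} {F : Type} [Field F] [Fintype F] [ExpChar F p]
    (hF : Fintype.card F = (p ^ hh) ^ 2) {m : ℕ} {x y : Fin m → F}
    (h : herm (p ^ hh) x y = 0) : herm (p ^ hh) y x = 0 := by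
  rw [← herm_swap hF, h, zero_pow (expChar_pow_pos F p hh).ne']

theorem le_polar_polar {p hh : ℕ} {F : Type} [Field F] [Fintype F] [ExpChar F p]
    (hF : Fintype.card F = (p ^ hh) ^ 2) {m : ℕ} (W : Submodule F (Fin m → F)) :
    W ≤ polar (p ^ hh) (polar (p ^ hh) W) := fun _ hx =>
  mem_polar.2 fun _ hy => herm_symm0 hF (mem_polar.1 hy _ hx)

theorem finrank_polar {p hh : ℕ} {F : Type} [Field F] [Fintype F] [ExpChar F p]
    {m : ℕ} (W : Submodule F (Fin m → F)) :
    Module.finrank F W + Module.finrank F (polar (p ^ hh) W) = m := by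
  classical
  let b := Module.finBasis F W
  let φ := iterateFrobeniusEquiv F p hh
  let A : Matrix (Fin (Module.finrank F W)) (Fin m) F :=
    fun i j => (b i : Fin m → F) j ^ (p ^ hh)
  have hb : LinearIndependent F (fun i => (b i : Fin m → F)) :=
    b.linearIndependent.map' W.subtype (Submodule.ker_subtype W)
  have hA : LinearIndependent F A.row := by
    let j : (Fin m → F) →+ (Fin m → F) :=
      { toFun := fun v k => φ (v k)
        map_zero' := by ext; simp
        map_add' := by intros; ext; simp }
    have := hb.map_of_injective_injective (fun r => φ.symm r) j
      (by intro r hr; simpa using hr)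
      (by
        intro v hv
        ext k
        have := congrFun hv k
        simpa [j] using this)
      (by intro r v; ext k; simp [j])
    exact this
  have hr := hA.rank_matrix
  have hk : polar (p ^ hh) W = LinearMap.ker A.mulVecLin := by
    ext y
    rw [mem_polar, LinearMap.mem_ker]
    have key : ∀ i, (A.mulVecLin y) i = herm (p ^ hh) y (b i : Fin m → F) := by
      intro i
      change ∑ k, (b i : Fin m → F) k ^ (p ^ hh) * y k = ∑ k, y k * (b i : Fin m → F) k ^ (p ^ hh)
      exact Finset.sum_congr rfl fun k _ => mul_comm _ _
    constructor
    · intro h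
      ext i
      rw [key, h _ (b i).2]; rfl
    · intro h x hx
      have hx' : (x : Fin m → F) = ∑ i, b.repr ⟨x, hx⟩ i • (b i : Fin m → F) := by
        have := congrArg W.subtype (b.sum_repr ⟨x, hx⟩)
        rw [map_sum] at this
        exact this.symm
      have hsum : herm (p ^ hh) y x
          = ∑ i, (b.repr ⟨x, hx⟩ i) ^ (p ^ hh) * herm (p ^ hh) y (b i : Fin m → F) := by
        conv_lhs => rw [hx']
        simp only [herm, Finset.sum_apply, sum_pow_char_pow, Finset.mul_sum, Pi.smul_apply,
          smul_eq_mul, mul_pow]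
        rw [Finset.sum_comm]
        refine Finset.sum_congr rfl fun i _ => Finset.sum_congr rfl fun k _ => by ring
      rw [hsum]
      refine Finset.sum_eq_zero fun i _ => ?_
      rw [← key, h]; simp
  have := LinearMap.finrank_range_add_finrank_ker A.mulVecLin
  rw [hk]
  rw [Matrix.rank] at hr
  simpa [hr] using this

theorem isotropic_mem {p hh : ℕ} {F : Type} [Field F] [Fintype F] [ExpChar F p]
    (hF : Fintype.card F = (p ^ hh) ^ 2) {m : ℕ} (U R : Submodule F (Fin m → F))
    (hRU : R ≤ U) (hRp : R ≤ polar (p ^ hh) U)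
    (hd : Module.finrank F U ≤ Module.finrank F R + 1) (x : Fin m → F) (hx : x ∈ U)
    (h0 : herm (p ^ hh) x x = 0) : x ∈ polar (p ^ hh) U := by
  by_cases hxR : x ∈ R
  · exact hRp hxR
  have hlt : R < R ⊔ Submodule.span F {x} := by
    refine lt_of_le_of_ne le_sup_left fun h => hxR ?_
    rw [h]
    exact Submodule.mem_sup_right (Submodule.mem_span_singleton_self x)
  have hle : R ⊔ Submodule.span F {x} ≤ U :=
    sup_le hRU ((Submodule.span_singleton_le_iff_mem x U).2 hx)
  have hfr := Submodule.finrank_lt_finrank_of_lt hlt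
  have heq := Submodule.eq_of_le_of_finrank_le hle (by omega)
  refine mem_polar.2 fun u hu => herm_symm0 hF ?_
  rw [← heq] at hu
  obtain ⟨r, hr, s, hs, rfl⟩ := Submodule.mem_sup.1 hu
  obtain ⟨c, rfl⟩ := Submodule.mem_span_singleton.1 hs
  rw [herm_add_left, herm_smul_left, h0, mem_polar.1 (hRp hr) x hx]
  simp

/-- If `π ∩ π^σ` has projective dimension at least `n-1`, then the points of
`H(2n+1,q²)` on `π` coincide with those on `π^σ`, and both coincide with the
set of all points of `π ∩ π^σ`. -/
theorem stmt4 (n q p hh : ℕ) (hn : 1 ≤ n) (hp : p.Prime) (hh1 : 1 ≤ hh)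
    (hq : q = p ^ hh)
    (F : Type) [Field F] [Fintype F] (hF : Fintype.card F = q ^ 2)
    (π : Submodule F (Fin (2*n+2) → F)) (hπ : Module.finrank F π = n + 1)
    (hdim : n ≤ Module.finrank F ↥(π ⊓ polar q π)) :
    {P : Submodule F (Fin (2*n+2) → F) | IsHermPoint q P ∧ P ≤ π}
      = {P : Submodule F (Fin (2*n+2) → F) | IsHermPoint q P ∧ P ≤ polar q π} ∧
    {P : Submodule F (Fin (2*n+2) → F) | IsHermPoint q P ∧ P ≤ π}
      = {P : Submodule F (Fin (2*n+2) → F) |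
          Module.finrank F P = 1 ∧ P ≤ π ⊓ polar q π} := by
  subst hq
  have : Fact p.Prime := ⟨hp⟩
  have : CharP F p := charP_of_card_eq_prime_pow (f := hh * 2) (by
    rw [hF, ← pow_mul])
  have : ExpChar F p := ExpChar.prime hp
  have h1 := finrank_polar (p := p) (hh := hh) π
  have h2 := finrank_polar (p := p) (hh := hh) (polar (p ^ hh) π)
  have hpp : π = polar (p ^ hh) (polar (p ^ hh) π) :=
    Submodule.eq_of_le_of_finrank_le (le_polar_polar hF π) (by omega)
  have k1 : ∀ x ∈ π, herm (p ^ hh) x x = 0 → x ∈ polar (p ^ hh) π :=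
    isotropic_mem hF π (π ⊓ polar (p ^ hh) π) inf_le_left inf_le_right (by omega)
  have k2 : ∀ x ∈ polar (p ^ hh) π, herm (p ^ hh) x x = 0 → x ∈ π := by
    intro x hx h0
    rw [hpp]
    exact isotropic_mem hF (polar (p ^ hh) π) (π ⊓ polar (p ^ hh) π) inf_le_right
      (inf_le_left.trans hpp.le) (by omega) x hx h0
  constructor
  · ext P
    constructor
    · rintro ⟨hP, hle⟩
      exact ⟨hP, fun x hx => k1 x (hle hx) (hP.2 x hx)⟩
    · rintro ⟨hP, hle⟩
      exact ⟨hP, fun x hx => k2 x (hle hx) (hP.2 x hx)⟩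
  · ext P
    constructor
    · rintro ⟨hP, hle⟩
      exact ⟨hP.1, fun x hx => ⟨hle hx, k1 x (hle hx) (hP.2 x hx)⟩⟩
    · rintro ⟨hP, hle⟩
      exact ⟨⟨hP, fun x hx => mem_polar.1 (hle hx).2 x (hle hx).1⟩, hle.trans inf_le_left⟩

end HermCode
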